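/- Let $\chi : [0,1] \to \mathbb{R}$ be differentiable with $\chi(t) > 0$ for all $t \in [0,1]$, let $v : [0,1] \to \mathbb{R}$ be nonnegative and integrable, let $K \ge 0$, and suppose $|\chi'(t)| \le K\,\chi(t)\,v(t)$ for all $t \in [0,1]$. Then for every $\delta \in (0,1)$: $\left|\chi(0)^{-\delta} - \chi(1)^{-\delta}\right| \;\le\; K\,\delta\,\Big(\int_0^1 \frac{v(t)}{\chi(t)}\,dt\Big)^{\delta}\Big(\int_0^1 v(t)\,dt\Big)^{1-\delta}.$ -/

import Mathlib

/-- Hölder's inequality for weighted geometric means of nonnegative integrable functions. -/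
theorem integral_rpow_mul_rpow_one_sub_le {α : Type*} [MeasurableSpace α]
    {μ : MeasureTheory.Measure α} {f g : α → ℝ} (hf0 : 0 ≤ᵐ[μ] f) (hg0 : 0 ≤ᵐ[μ] g)
    (hf : MeasureTheory.Integrable f μ) (hg : MeasureTheory.Integrable g μ)
    {δ : ℝ} (hδ : δ ∈ Set.Ioo (0 : ℝ) 1) :
    MeasureTheory.Integrable (fun a ↦ f a ^ δ * g a ^ (1 - δ)) μ ∧
      ∫ a, f a ^ δ * g a ^ (1 - δ) ∂μ ≤ (∫ a, f a ∂μ) ^ δ * (∫ a, g a ∂μ) ^ (1 - δ) := by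
  obtain ⟨hδ0, hδ1⟩ := hδ
  have memLp_rpow {h : α → ℝ} (h0 : 0 ≤ᵐ[μ] h) (hh : MeasureTheory.Integrable h μ) {s : ℝ}
      (hs : 0 < s) : MeasureTheory.MemLp (fun a ↦ h a ^ s) (ENNReal.ofReal s⁻¹) μ := by
    have := (MeasureTheory.memLp_one_iff_integrable.2 hh).norm_rpow_div (ENNReal.ofReal s)
    rw [ENNReal.toReal_ofReal hs.le, one_div, ← ENNReal.ofReal_inv_of_pos hs] at this
    refine this.ae_eq ?_
    filter_upwards [h0] with a ha
    rw [Real.norm_of_nonneg ha]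
  have integral_rpow {h : α → ℝ} (h0 : 0 ≤ᵐ[μ] h) {s : ℝ} (hs : 0 < s) :
      ∫ a, (h a ^ s) ^ s⁻¹ ∂μ = ∫ a, h a ∂μ := by
    refine MeasureTheory.integral_congr_ae ?_
    filter_upwards [h0] with a ha
    exact Real.rpow_rpow_inv ha hs.ne'
  have hδ' : 0 < 1 - δ := sub_pos.2 hδ1
  have hpq : (δ⁻¹).HolderConjugate (1 - δ)⁻¹ :=
    Real.HolderConjugate.inv_one_sub_inv hδ0 hδ1
  have hF := memLp_rpow hf0 hf hδ0
  have hG := memLp_rpow hg0 hg hδ'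
  have : ENNReal.HolderConjugate (ENNReal.ofReal δ⁻¹) (ENNReal.ofReal (1 - δ)⁻¹) :=
    hpq.ennrealOfReal
  refine ⟨hF.integrable_mul hG, ?_⟩
  have holder := MeasureTheory.integral_mul_le_Lp_mul_Lq_of_nonneg hpq
    (hf0.mono fun a ha ↦ Real.rpow_nonneg ha δ)
    (hg0.mono fun a ha ↦ Real.rpow_nonneg ha (1 - δ)) hF hG
  simpa only [integral_rpow hf0 hδ0, integral_rpow hg0 hδ', one_div, inv_inv] using holder

/-- Hölder estimate for the difference of negative powers of a positive differentiable
function `χ` whose logarithmic derivative is controlled by `K v`: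
`|χ(0)^(-δ) - χ(1)^(-δ)| ≤ K δ (∫ v/χ)^δ (∫ v)^(1-δ)`. -/
theorem chi_power_difference_estimate (χ χ' v : ℝ → ℝ) (K : ℝ) (hK : 0 ≤ K)
    (hχpos : ∀ t ∈ Set.Icc (0:ℝ) 1, 0 < χ t)
    (hχ : ∀ t ∈ Set.Icc (0:ℝ) 1, HasDerivAt χ (χ' t) t)
    (hv : ∀ t ∈ Set.Icc (0:ℝ) 1, 0 ≤ v t)
    (hvint : IntervalIntegrable v MeasureTheory.volume 0 1)
    (hbound : ∀ t ∈ Set.Icc (0:ℝ) 1, |χ' t| ≤ K * χ t * v t)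
    (δ : ℝ) (hδ : δ ∈ Set.Ioo (0:ℝ) 1) :
    |χ 0 ^ (-δ) - χ 1 ^ (-δ)| ≤
      K * δ * (∫ t in (0:ℝ)..1, v t / χ t) ^ δ * (∫ t in (0:ℝ)..1, v t) ^ (1 - δ) := by
  have hcont : ContinuousOn χ (Set.Icc 0 1) := HasDerivAt.continuousOn hχ
  have hwint : IntervalIntegrable (fun t ↦ v t / χ t) MeasureTheory.volume 0 1 := by
    simp only [div_eq_mul_inv]
    refine hvint.mul_continuousOn ?_
    rw [Set.uIcc_of_le zero_le_one]
    exact hcont.inv₀ fun t ht ↦ (hχpos t ht).ne'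
  have ae_mem : ∀ᵐ t ∂MeasureTheory.volume.restrict (Set.Ioc (0:ℝ) 1), t ∈ Set.Icc (0:ℝ) 1 :=
    (MeasureTheory.ae_restrict_mem measurableSet_Ioc).mono fun _ ht ↦ Set.Ioc_subset_Icc_self ht
  obtain ⟨h_integrable, hle⟩ := integral_rpow_mul_rpow_one_sub_le
    (ae_mem.mono fun t ht ↦ div_nonneg (hv t ht) (hχpos t ht).le) (ae_mem.mono hv)
    hwint.1 hvint.1 hδ
  have hderiv : ∀ t ∈ Set.Icc (0:ℝ) 1,
      HasDerivAt (fun t ↦ χ t ^ (-δ)) (χ' t * -δ * χ t ^ (-δ - 1)) t :=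
    fun t ht ↦ (hχ t ht).rpow_const (.inl (hχpos t ht).ne')
  have hderiv_le : ∀ t ∈ Set.Icc (0:ℝ) 1, ‖χ' t * -δ * χ t ^ (-δ - 1)‖ ≤
      K * δ * ((v t / χ t) ^ δ * v t ^ (1 - δ)) := by
    intro t ht
    have hχt := hχpos t ht
    have hvt : v t ^ δ * v t ^ (1 - δ) = v t := by
      rw [← Real.rpow_add' (hv t ht) (by simp), add_sub_cancel, Real.rpow_one]
    calc ‖χ' t * -δ * χ t ^ (-δ - 1)‖ = |χ' t| * (δ * χ t ^ (-δ - 1)) := by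
          rw [norm_mul, norm_mul, norm_neg, Real.norm_of_nonneg hδ.1.le,
            Real.norm_of_nonneg (Real.rpow_nonneg hχt.le _), Real.norm_eq_abs, mul_assoc]
      _ ≤ K * χ t * v t * (δ * χ t ^ (-δ - 1)) :=
          mul_le_mul_of_nonneg_right (hbound t ht)
            (mul_nonneg hδ.1.le (Real.rpow_nonneg hχt.le _))
      _ = K * δ * ((v t / χ t) ^ δ * v t ^ (1 - δ)) := by
          rw [Real.div_rpow (hv t ht) hχt.le, div_mul_eq_mul_div, hvt,
            Real.rpow_sub_one hχt.ne', Real.rpow_neg hχt.le]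
          field_simp
  rw [abs_sub_comm, ← Real.norm_eq_abs]
  calc ‖χ 1 ^ (-δ) - χ 0 ^ (-δ)‖
      ≤ ∫ t in (0:ℝ)..1, K * δ * ((v t / χ t) ^ δ * v t ^ (1 - δ)) := by
        refine norm_sub_le_integral_of_norm_deriv_le_of_le (f := fun t ↦ χ t ^ (-δ)) zero_le_one
          (HasDerivAt.continuousOn hderiv)
          (fun t ht ↦
            (hderiv t (Set.Ioo_subset_Icc_self ht)).differentiableAt.differentiableWithinAt)
          (.of_forall fun t ht ↦ ?_)
          ((intervalIntegrable_iff_integrableOn_Ioc_of_le zero_le_one).2 (h_integrable.const_mul _))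
        rw [(hderiv t (Set.Ioo_subset_Icc_self ht)).deriv]
        exact hderiv_le t (Set.Ioo_subset_Icc_self ht)
    _ ≤ K * δ * (∫ t in (0:ℝ)..1, v t / χ t) ^ δ * (∫ t in (0:ℝ)..1, v t) ^ (1 - δ) := by
        rw [intervalIntegral.integral_const_mul, mul_assoc (K * δ)]
        simp only [intervalIntegral.integral_of_le zero_le_one]
        exact mul_le_mul_of_nonneg_left hle (mul_nonneg hK hδ.1.le)
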